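/- arXiv:1004.0994 — 2 statements merged into one kernel-verified Lean document; each statement's English description precedes it below -/
import Mathlib

section
/- Let F be a field and let B be a finite-dimensional associative unital F-algebra. If σ and τ are both standard involutions on B, then σ = τ; that is, a standard involution on B, if it exists, is unique. -/
/-- A standard involution on an associative unital `F`-algebra `B` is an `F`-linear map
`σ : B → B` with `σ 1 = 1`, `σ (x * y) = σ y * σ x`, `σ (σ x) = x`, and such that
`x * σ x` lies in the image of `F` in `B` for every `x`. -/
def IsStandardInvolution (F B : Type*) [Field F] [Ring B] [Algebra F B]
    (σ : B →ₗ[F] B) : Prop :=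
  σ 1 = 1 ∧ (∀ x y : B, σ (x * y) = σ y * σ x) ∧ (∀ x : B, σ (σ x) = x) ∧
    ∀ x : B, x * σ x ∈ (algebraMap F B).range

namespace IsStandardInvolution

variable {F B : Type*} [Field F] [Ring B] [Algebra F B] {σ : B →ₗ[F] B}

theorem apply_algebraMap (hσ : IsStandardInvolution F B σ) (a : F) :
    σ (algebraMap F B a) = algebraMap F B a := by
  rw [Algebra.algebraMap_eq_smul_one, map_smul, hσ.1]

/-- The reduced trace `x + σ x` is a scalar. -/
theorem exists_apply_eq_sub (hσ : IsStandardInvolution F B σ) (x : B) :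
    ∃ t : F, σ x = algebraMap F B t - x := by
  obtain ⟨n, hn⟩ := hσ.2.2.2 x
  obtain ⟨m, hm⟩ := hσ.2.2.2 (1 + x)
  refine ⟨m - n - 1, ?_⟩
  rw [map_sub, map_sub, map_one, hn, hm, map_add, hσ.1]
  noncomm_ring

end IsStandardInvolution

/-- Let `F` be a field and let `B` be a finite-dimensional associative
unital `F`-algebra.  A standard involution on `B`, if it exists, is unique. -/
theorem standardInvolution_unique
    (F B : Type*) [Field F] [Ring B] [Algebra F B] [FiniteDimensional F B]
    (σ τ : B →ₗ[F] B)
    (hσ : IsStandardInvolution F B σ) (hτ : IsStandardInvolution F B τ) :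
    σ = τ := by
  ext x
  obtain ⟨t, ht⟩ := hσ.exists_apply_eq_sub x
  obtain ⟨u, hu⟩ := hτ.exists_apply_eq_sub x
  obtain ⟨n, hn⟩ := hσ.2.2.2 x
  obtain ⟨m, hm⟩ := hτ.2.2.2 x
  by_cases htu : t = u
  · rw [ht, hu, htu]
  have key : (t - u) • x = algebraMap F B (n - m) := by
    rw [map_sub, hn, hm, ht, hu, Algebra.smul_def, Algebra.commutes, map_sub]
    noncomm_ring
  have hx : x = algebraMap F B ((t - u)⁻¹ * (n - m)) := by
    rw [map_mul, ← key, ← Algebra.smul_def, inv_smul_smul₀ (sub_ne_zero.2 htu)]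
  rw [hx, hσ.apply_algebraMap, hτ.apply_algebraMap]
end

section
/- Let F be a field with char F ≠ 2 and let B be a 4-dimensional associative unital F-algebra with a standard involution σ. Then the Jacobson radical of B equals the radical of the reduced norm form, i.e., rad(B) = {x ∈ B : T(x,y) = 0 for all y ∈ B}, where T is the polar bilinear form of nrd. -/
namespace IsStandardInvolution

variable {F B : Type*} [Field F] [Ring B] [Algebra F B] {σ : B →ₗ[F] B}

/-- The reduced trace `x + σ x` is a scalar. -/
theorem add_apply_mem_range (hσ : IsStandardInvolution F B σ) (x : B) :
    x + σ x ∈ (algebraMap F B).range := by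
  obtain ⟨h1, -, -, hn⟩ := hσ
  have key : x + σ x = (x + 1) * σ (x + 1) - x * σ x - 1 := by
    rw [map_add, h1]; noncomm_ring
  rw [key]
  exact sub_mem (sub_mem (hn _) (hn _)) (one_mem _)

theorem commute_apply (hσ : IsStandardInvolution F B σ) (x : B) : Commute x (σ x) := by
  obtain ⟨t, ht⟩ := hσ.add_apply_mem_range x
  rw [← sub_eq_of_eq_add' ht]
  exact (Algebra.commute_algebraMap_right t x).sub_right (Commute.refl x)

/-- The reduced trace is symmetric: `trd (x * y) = trd (y * x)`. -/
theorem mul_add_apply_mul_comm (hσ : IsStandardInvolution F B σ) (x y : B) :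
    x * y + σ (x * y) = y * x + σ (y * x) := by
  have hxy := (hσ.commute_apply (x + σ y)).eq
  have hx := (hσ.commute_apply x).eq
  have hy := (hσ.commute_apply y).eq
  obtain ⟨-, hm, hi, -⟩ := hσ
  rw [map_add, hi, add_mul, mul_add, mul_add, add_mul, mul_add, mul_add, hx, hy] at hxy
  rw [hm, hm]
  have : x * y + σ y * σ x - (y * x + σ x * σ y) = 0 := by
    rw [← sub_eq_zero] at hxy
    rw [← hxy]; abel
  exact sub_eq_zero.mp this

theorem isNilpotent_apply (hσ : IsStandardInvolution F B σ) {x : B} (hx : IsNilpotent x) :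
    IsNilpotent (σ x) := by
  obtain ⟨n, hn⟩ := hx
  have hpow : ∀ k, σ (x ^ k) = σ x ^ k := by
    intro k
    induction k with
    | zero => simpa using hσ.1
    | succ k ih => rw [pow_succ, hσ.2.1, ih, pow_succ']
  exact ⟨n, by rw [← hpow, hn, map_zero]⟩

/-- Nilpotent elements have reduced trace zero. -/
theorem add_apply_eq_zero_of_isNilpotent (hσ : IsStandardInvolution F B σ) {x : B}
    (hx : IsNilpotent x) : x + σ x = 0 := by
  nontriviality B
  obtain ⟨t, ht⟩ := hσ.add_apply_mem_range x
  have hnil := (hσ.commute_apply x).isNilpotent_add hx (hσ.isNilpotent_apply hx)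
  rw [← ht, IsNilpotent.map_iff (algebraMap F B).injective, isNilpotent_iff_eq_zero] at hnil
  rw [← ht, hnil, map_zero]

/-- The radical of the reduced trace form, as a two-sided ideal. -/
def traceRadical (hσ : IsStandardInvolution F B σ) : TwoSidedIdeal B :=
  TwoSidedIdeal.mk' {x | ∀ y, x * y + σ (x * y) = 0}
    (fun y => by simp)
    (fun {x z} hx hz y => by
      rw [add_mul, map_add, add_add_add_comm, hx, hz, add_zero])
    (fun {x} hx y => by
      rw [neg_mul, map_neg, ← neg_add, hx, neg_zero])
    (fun {b x} hx y => by
      rw [mul_assoc, hσ.mul_add_apply_mul_comm, mul_assoc]; exact hx _)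
    (fun {x b} hx y => by rw [mul_assoc]; exact hx _)

theorem mem_traceRadical (hσ : IsStandardInvolution F B σ) {x : B} :
    x ∈ hσ.traceRadical ↔ ∀ y, x * y + σ (x * y) = 0 := by
  simp [traceRadical, TwoSidedIdeal.mem_mk']

/-- The trace form at `(x, σ y)` is the polar form of the reduced norm at `(x, y)`. -/
theorem polar_eq (hσ : IsStandardInvolution F B σ) (x y : B) :
    (x + y) * σ (x + y) - x * σ x - y * σ y = x * σ y + σ (x * σ y) := by
  rw [hσ.2.1, hσ.2.2.1, map_add]; noncomm_ring

theorem isNilpotent_of_mem_traceRadical (hσ : IsStandardInvolution F B σ)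
    (hchar : ringChar F ≠ 2) {x : B} (hx : x ∈ hσ.traceRadical) : IsNilpotent x := by
  rw [mem_traceRadical] at hx
  have htr : σ x = -x := by
    have := hx 1
    rw [mul_one] at this
    exact (neg_eq_of_add_eq_zero_right this).symm
  have hsq := hx x
  rw [hσ.2.1, htr, neg_mul_neg, ← two_smul F (x * x)] at hsq
  exact ⟨2, by rw [sq]; exact (smul_eq_zero_iff_right (Ring.two_ne_zero hchar)).mp hsq⟩

end IsStandardInvolution

/-- Let `F` be a field with `char F ≠ 2` and let `B` be a
`4`-dimensional associative unital `F`-algebra with a standard involution `σ`.  Then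
the Jacobson radical of `B` (the largest two-sided ideal all of whose elements are
nilpotent) equals the radical of the reduced norm form, i.e.\ there is a two-sided
ideal of `B` whose elements are exactly `{x : ∀ y, T(x,y) = 0}` (where
`T(x,y) = nrd(x+y) − nrd(x) − nrd(y)` and `nrd x = x * σ x`), all of whose elements
are nilpotent, and which contains every two-sided nil ideal of `B`. -/
theorem jacobsonRadical_eq_rad_nrd
    (F B : Type*) [Field F] [Ring B] [Algebra F B]
    (hchar : (ringChar F) ≠ 2)
    (hdim : Module.finrank F B = 4)
    (σ : B →ₗ[F] B) (hσ : IsStandardInvolution F B σ) :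
    ∃ I : TwoSidedIdeal B,
      (∀ x : B, x ∈ I ↔ ∀ y : B, (x + y) * σ (x + y) - x * σ x - y * σ y = 0) ∧
      (∀ x ∈ I, IsNilpotent x) ∧
      (∀ J : TwoSidedIdeal B, (∀ x ∈ J, IsNilpotent x) → J ≤ I) := by
  refine ⟨hσ.traceRadical, fun x => ?_, fun x hx =>
    hσ.isNilpotent_of_mem_traceRadical hchar hx, fun J hJ x hx => ?_⟩
  · simp_rw [hσ.mem_traceRadical, hσ.polar_eq]
    exact ⟨fun h y => h _, fun h y => by simpa only [hσ.2.2.1 y] using h (σ y)⟩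
  · exact hσ.mem_traceRadical.mpr fun y =>
      hσ.add_apply_eq_zero_of_isNilpotent (hJ _ (J.mul_mem_right _ _ hx))
end
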